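/- Let A₁ = [0,1/3] ∩ ℙ and A₂ = [2/3,1] ∩ ℙ with the subspace topologies from ℝ, let Y be the topological sum A₁ ⊕ A₂, and let Q' = [2/3,1] ∩ ℚ. For q ∈ Q' define i(q) : Y × Y → ℝ by i(q)(x,y) = |x − y| if (x,y) ∈ A₁² or (x,y) ∈ A₂², i(q)(x,y) = x + |y − q| if x ∈ A₁ and y ∈ A₂, and i(q)(x,y) = |x − q| + y if x ∈ A₂ and y ∈ A₁. Then for every q ∈ Q', the function i(q) is a bounded admissible metric on Y (i.e., i(q) ∈ AM(Y)), and for all q, p ∈ Q' the sup-metric distance satisfies D(i(q), i(p)) = |q − p|; in particular, i : Q' → AM(Y) is an isometric embedding. -/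

import Mathlib

open Set Filter Topology UniformConvergence

/-- `d : X × X → ℝ` is a metric on `X`. -/
def IsMetricFun {X : Type*} (d : X × X → ℝ) : Prop :=
  (∀ x y : X, d (x, y) = 0 ↔ x = y) ∧ (∀ x y : X, d (x, y) = d (y, x)) ∧
    (∀ x y z : X, d (x, z) ≤ d (x, y) + d (y, z))

/-- `d` induces the topology of `X`, i.e. `d` is an admissible metric. -/
def InducesTopology {X : Type*} [TopologicalSpace X] (d : X × X → ℝ) : Prop :=
  ∀ s : Set X, IsOpen s ↔ ∀ x ∈ s, ∃ ε > 0, ∀ y : X, d (x, y) < ε → y ∈ s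

/-- `d` is a bounded real-valued function. -/
def BoundedFun {X : Type*} (d : X × X → ℝ) : Prop := ∃ C : ℝ, ∀ p : X × X, |d p| ≤ C

/-- `AM X`: the set of bounded admissible metrics on `X`, regarded as a subset of the space
`C(X²)` of bounded continuous real-valued functions on `X × X`, which carries the
sup-metric (every admissible metric is continuous on `X × X`, so bounded admissible
metrics are exactly the elements of `C(X²)` satisfying the two conditions below). -/
def AM (X : Type*) [TopologicalSpace X] : Set (BoundedContinuousFunction (X × X) ℝ) :=
  {f | IsMetricFun (⇑f) ∧ InducesTopology (⇑f)}

/-- A topological space is completely metrizable if its topology is induced by some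
complete metric. -/
def CompletelyMetrizable (Z : Type*) [t : TopologicalSpace Z] : Prop :=
  ∃ m : MetricSpace Z, m.toPseudoMetricSpace.toUniformSpace.toTopologicalSpace = t ∧
    @CompleteSpace Z m.toPseudoMetricSpace.toUniformSpace

/-- `A₁ = [0,1/3] ∩ ℙ`. -/
def A1 : Set ℝ := Set.Icc 0 (1 / 3) ∩ {x | Irrational x}

/-- `A₂ = [2/3,1] ∩ ℙ`. -/
def A2 : Set ℝ := Set.Icc (2 / 3) 1 ∩ {x | Irrational x}

/-- `Q' = [2/3,1] ∩ ℚ`. -/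
def Qset' : Set ℝ := Set.Icc (2 / 3) 1 ∩ Set.range ((↑) : ℚ → ℝ)

/-- The topological sum `Y = A₁ ⊕ A₂`. -/
abbrev Ysum : Type := ↥A1 ⊕ ↥A2

/-- The metric `i(q)` on `Y = A₁ ⊕ A₂` associated to `q`. -/
noncomputable def iq (q : ℝ) : Ysum × Ysum → ℝ
  | (Sum.inl x, Sum.inl y) => |(x : ℝ) - (y : ℝ)|
  | (Sum.inr x, Sum.inr y) => |(x : ℝ) - (y : ℝ)|
  | (Sum.inl x, Sum.inr y) => (x : ℝ) + |(y : ℝ) - q|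
  | (Sum.inr x, Sum.inl y) => |(x : ℝ) - q| + (y : ℝ)

theorem isMetricFun_iq {q : ℝ} (hq : q ∈ Qset') : IsMetricFun (iq q) := by
  obtain ⟨-, r, rfl⟩ := hq
  have pos1 : ∀ x : A1, 0 < (x : ℝ) := fun x => lt_of_le_of_ne x.2.1.1 x.2.2.ne_zero.symm
  refine ⟨?_, ?_, ?_⟩
  · rintro (x | x) (y | y)
    · simp [iq, sub_eq_zero, Subtype.ext_iff]
    · have := pos1 x
      have := abs_nonneg ((y : ℝ) - r)
      simp only [iq, reduceCtorEq, iff_false]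
      linarith
    · have := pos1 y
      have := abs_nonneg ((x : ℝ) - r)
      simp only [iq, reduceCtorEq, iff_false]
      linarith
    · simp [iq, sub_eq_zero, Subtype.ext_iff]
  · rintro (x | x) (y | y) <;> simp only [iq]
    · exact abs_sub_comm _ _
    · exact add_comm _ _
    · exact add_comm _ _
    · exact abs_sub_comm _ _
  · rintro (x | x) (y | y) (z | z) <;> simp only [iq]
    · exact abs_sub_le _ _ _
    · linarith [le_abs_self ((x : ℝ) - y)]
    · have := abs_nonneg ((y : ℝ) - r)
      rw [abs_le]
      constructor <;> linarith [pos1 x, pos1 z]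
    · linarith [abs_sub_le (z : ℝ) y r, abs_sub_comm (z : ℝ) y]
    · linarith [neg_abs_le ((y : ℝ) - z)]
    · linarith [abs_sub_le (x : ℝ) r z, abs_sub_comm (z : ℝ) r, pos1 y]
    · linarith [abs_sub_le (x : ℝ) y r]
    · exact abs_sub_le _ _ _

theorem inducesTopology_iq {q : ℝ} (hq : q ∈ Qset') : InducesTopology (iq q) := by
  obtain ⟨-, r, rfl⟩ := hq
  intro s
  rw [isOpen_sum_iff, Metric.isOpen_iff, Metric.isOpen_iff]
  constructor
  · rintro ⟨h1, h2⟩ (x | x) hx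
    · obtain ⟨ε, hε, h⟩ := h1 x hx
      have hx0 : 0 < (x : ℝ) := lt_of_le_of_ne x.2.1.1 x.2.2.ne_zero.symm
      refine ⟨min ε x, lt_min hε hx0, ?_⟩
      rintro (y | y) hy <;> simp only [iq, lt_min_iff] at hy
      · refine h ?_
        rw [Metric.mem_ball, dist_comm, Subtype.dist_eq, Real.dist_eq]
        exact hy.1
      · linarith [hy.2, abs_nonneg ((y : ℝ) - r)]
    · obtain ⟨ε, hε, h⟩ := h2 x hx
      have hx0 : 0 < |(x : ℝ) - r| := abs_pos.2 (sub_ne_zero.2 (x.2.2.ne_rat r))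
      refine ⟨min ε |(x : ℝ) - r|, lt_min hε hx0, ?_⟩
      rintro (y | y) hy <;> simp only [iq, lt_min_iff] at hy
      · have := y.2.1.1
        linarith [hy.2]
      · refine h ?_
        rw [Metric.mem_ball, dist_comm, Subtype.dist_eq, Real.dist_eq]
        exact hy.1
  · intro h
    constructor
    · intro x hx
      obtain ⟨ε, hε, h⟩ := h (Sum.inl x) hx
      refine ⟨ε, hε, fun y hy => h (Sum.inl y) ?_⟩
      rwa [Metric.mem_ball, dist_comm, Subtype.dist_eq, Real.dist_eq] at hy
    · intro x hx
      obtain ⟨ε, hε, h⟩ := h (Sum.inr x) hx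
      refine ⟨ε, hε, fun y hy => h (Sum.inr y) ?_⟩
      rwa [Metric.mem_ball, dist_comm, Subtype.dist_eq, Real.dist_eq] at hy

theorem boundedFun_iq (q : ℝ) : BoundedFun (iq q) := by
  refine ⟨2 + |q|, ?_⟩
  have bound : ∀ a b c : ℝ, 0 ≤ a → a ≤ 1 → 0 ≤ b → b ≤ 1 →
      |(|a - b|)| ≤ 2 + |c| ∧ |a + (|b - c|)| ≤ 2 + |c| := by
    intro a b c ha ha' hb hb'
    have h1 : |a - b| ≤ 1 := abs_le.2 ⟨by linarith, by linarith⟩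
    have h2 : |b - c| ≤ |b| + |c| := abs_sub _ _
    rw [abs_of_nonneg hb] at h2
    rw [abs_abs, abs_of_nonneg (show 0 ≤ a + (|b - c|) by positivity)]
    exact ⟨by linarith [abs_nonneg c], by linarith⟩
  rintro ⟨x | x, y | y⟩ <;> obtain ⟨x, ⟨hx, hx'⟩, -⟩ := x <;> obtain ⟨y, ⟨hy, hy'⟩, -⟩ := y <;>
    simp only [iq]
  · exact (bound x y q (by linarith) (by linarith) (by linarith) (by linarith)).1
  · exact (bound x y q (by linarith) (by linarith) (by linarith) (by linarith)).2
  · rw [add_comm]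
    exact (bound y x q (by linarith) (by linarith) (by linarith) (by linarith)).2
  · exact (bound x y q (by linarith) (by linarith) (by linarith) (by linarith)).1

theorem abs_iq_sub_iq_le (q p : ℝ) (z : Ysum × Ysum) : |iq q z - iq p z| ≤ |q - p| := by
  have key : ∀ y : ℝ, |(|y - q| - |y - p|)| ≤ |q - p| := fun y => by
    simpa [abs_sub_comm] using abs_abs_sub_abs_le (y - q) (y - p)
  rcases z with ⟨x | x, y | y⟩ <;> simp only [iq]
  · simp
  · simpa using key y
  · simpa using key x
  · simp

theorem A1_nonempty : A1.Nonempty := by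
  obtain ⟨x, hx, h0, h1⟩ := exists_irrational_btwn (show (0 : ℝ) < 1 / 3 by norm_num)
  exact ⟨x, ⟨h0.le, h1.le⟩, hx⟩

theorem exists_lt_abs_iq_sub_iq {q p w : ℝ} (hq : 2 / 3 ≤ q) (hp : p ≤ 1) (hqp : q < p)
    (hw : w < p - q) : ∃ z, w < |iq q z - iq p z| := by
  obtain ⟨x, hx⟩ := A1_nonempty
  obtain ⟨y, hy, h0, h1⟩ :=
    exists_irrational_btwn (show q < min p ((p + q - w) / 2) from lt_min hqp (by linarith))
  rw [lt_min_iff] at h1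
  refine ⟨(Sum.inl ⟨x, hx⟩, Sum.inr ⟨y, ⟨by linarith, by linarith⟩, hy⟩), ?_⟩
  simp only [iq]
  rw [abs_of_pos (sub_pos.2 h0), abs_of_neg (sub_neg.2 h1.1), abs_sub_comm]
  exact lt_of_lt_of_le (by linarith) (le_abs_self _)

theorem iSup_abs_iq_sub_iq {q p : ℝ} (hq : q ∈ Icc (2 / 3 : ℝ) 1) (hp : p ∈ Icc (2 / 3 : ℝ) 1) :
    (⨆ z : Ysum × Ysum, |iq q z - iq p z|) = |q - p| := by
  obtain ⟨x, hx⟩ := A1_nonempty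
  have : Nonempty (Ysum × Ysum) := ⟨(Sum.inl ⟨x, hx⟩, Sum.inl ⟨x, hx⟩)⟩
  refine ciSup_eq_of_forall_le_of_forall_lt_exists_gt (abs_iq_sub_iq_le q p) fun w hw => ?_
  rcases lt_trichotomy q p with h | rfl | h
  · rw [abs_of_neg (sub_neg.2 h), neg_sub] at hw
    exact exists_lt_abs_iq_sub_iq hq.1 hp.2 h hw
  · exact ⟨Classical.arbitrary _, by simpa using hw⟩
  · rw [abs_of_pos (sub_pos.2 h)] at hw
    obtain ⟨z, hz⟩ := exists_lt_abs_iq_sub_iq hp.1 hq.2 h hw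
    exact ⟨z, by rwa [abs_sub_comm]⟩

/-- For every `q ∈ Q' = [2/3,1] ∩ ℚ`, the function `i(q)` is a bounded
admissible metric on `Y = A₁ ⊕ A₂`, and for all `q, p ∈ Q'` the sup-metric distance
satisfies `D(i(q), i(p)) = |q - p|`; in particular `i : Q' → AM(Y)` is an isometric
embedding. -/
theorem iq_isometric_embedding :
    (∀ q ∈ Qset', IsMetricFun (iq q) ∧ InducesTopology (iq q) ∧ BoundedFun (iq q)) ∧
      (∀ q ∈ Qset', ∀ p ∈ Qset', (⨆ z : Ysum × Ysum, |iq q z - iq p z|) = |q - p|) := by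
  exact ⟨fun q hq => ⟨isMetricFun_iq hq, inducesTopology_iq hq, boundedFun_iq q⟩,
    fun q hq p hp => iSup_abs_iq_sub_iq hq.1 hp.1⟩
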